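/- For all positive edge weights c₁, c₂, c₃ on the path P₄, the product of the algebraic connectivity and the total effective resistance satisfies λ₂(c₁,c₂,c₃) · (3/c₁ + 4/c₂ + 3/c₃) ≤ 20 − 8√3. -/

import Mathlib

open Matrix

/-- The Laplacian of the weighted path `P₄` with edge weights `c₁, c₂, c₃`. -/
noncomputable def lapP4 (c₁ c₂ c₃ : ℝ) : Matrix (Fin 4) (Fin 4) ℝ :=
  !![c₁, -c₁, 0, 0; -c₁, c₁ + c₂, -c₂, 0; 0, -c₂, c₂ + c₃, -c₃; 0, 0, -c₃, c₃]

/-- The algebraic connectivity `λ₂` of the weighted path `P₄`: the minimum (here: infimum,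
which is attained) of the Rayleigh quotient `⟨Lx, x⟩ / ⟨x, x⟩` over nonzero `x ∈ ℝ⁴` with
`x₁ + x₂ + x₃ + x₄ = 0`; equivalently, the second smallest eigenvalue of the Laplacian. -/
noncomputable def lambda2P4 (c₁ c₂ c₃ : ℝ) : ℝ :=
  sInf {R : ℝ | ∃ x : Fin 4 → ℝ, x ≠ 0 ∧ x 0 + x 1 + x 2 + x 3 = 0 ∧
    R = ((lapP4 c₁ c₂ c₃).mulVec x ⬝ᵥ x) / (x ⬝ᵥ x)}

/-- The quadratic form of the Laplacian of the weighted path is the weighted sum of the squared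
differences along the edges. -/
theorem lapP4_mulVec_dotProduct (c₁ c₂ c₃ : ℝ) (x : Fin 4 → ℝ) :
    (lapP4 c₁ c₂ c₃).mulVec x ⬝ᵥ x =
      c₁ * (x 0 - x 1) ^ 2 + c₂ * (x 1 - x 2) ^ 2 + c₃ * (x 2 - x 3) ^ 2 := by
  simp [lapP4, Matrix.mulVec, dotProduct, Fin.sum_univ_four]
  ring

/-- The algebraic connectivity is at most the Rayleigh quotient of any admissible vector. -/
theorem lambda2P4_le_rayleigh {c₁ c₂ c₃ : ℝ} (hc₁ : 0 ≤ c₁) (hc₂ : 0 ≤ c₂) (hc₃ : 0 ≤ c₃)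
    {x : Fin 4 → ℝ} (hx : x ≠ 0) (hsum : x 0 + x 1 + x 2 + x 3 = 0) :
    lambda2P4 c₁ c₂ c₃ ≤ ((lapP4 c₁ c₂ c₃).mulVec x ⬝ᵥ x) / (x ⬝ᵥ x) := by
  refine csInf_le ⟨0, ?_⟩ ⟨x, hx, hsum, rfl⟩
  rintro _ ⟨y, -, -, rfl⟩
  rw [lapP4_mulVec_dotProduct]
  have hy : 0 ≤ y ⬝ᵥ y := Finset.sum_nonneg fun i _ => mul_self_nonneg (y i)
  positivity

/-- **The maximal product of algebraic connectivity and total effective resistance for `P₄`.**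
For all positive edge weights `c₁, c₂, c₃` on the path `P₄`, the algebraic connectivity
and the total effective resistance `R = 3/c₁ + 4/c₂ + 3/c₃` satisfy
`λ₂(c₁, c₂, c₃) * (3/c₁ + 4/c₂ + 3/c₃) ≤ 20 - 8√3`. -/
theorem lambda2P4_mul_resistance_le
    (c₁ c₂ c₃ : ℝ) (hc₁ : 0 < c₁) (hc₂ : 0 < c₂) (hc₃ : 0 < c₃) :
    lambda2P4 c₁ c₂ c₃ * (3 / c₁ + 4 / c₂ + 3 / c₃) ≤ 20 - 8 * Real.sqrt 3 := by
  have hs : Real.sqrt 3 ^ 2 = 3 := Real.sq_sqrt (by norm_num)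
  set s := Real.sqrt 3
  set S := 3 / c₁ + 4 / c₂ + 3 / c₃ with hS
  have hSpos : 0 < S := by positivity
  -- The zero-sum vector with consecutive differences `s / c₁`, `2 / c₂`, `s / c₃`.
  obtain ⟨x, hsum, h01, h12, h23⟩ : ∃ x : Fin 4 → ℝ, x 0 + x 1 + x 2 + x 3 = 0 ∧
      x 0 - x 1 = s / c₁ ∧ x 1 - x 2 = 2 / c₂ ∧ x 2 - x 3 = s / c₃ := by
    refine ⟨![(3 * (s / c₁) + 2 * (2 / c₂) + s / c₃) / 4,
      (-(s / c₁) + 2 * (2 / c₂) + s / c₃) / 4, (-(s / c₁) - 2 * (2 / c₂) + s / c₃) / 4,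
      (-(s / c₁) - 2 * (2 / c₂) - 3 * (s / c₃)) / 4], ?_, ?_, ?_, ?_⟩ <;> simp <;> ring
  have hquad : (lapP4 c₁ c₂ c₃).mulVec x ⬝ᵥ x = S := by
    rw [lapP4_mulVec_dotProduct, h01, h12, h23, hS]
    simp only [div_pow, hs]
    field_simp
    ring
  have hpair : x ⬝ᵥ ![s, 2 - s, s - 2, -s] = S := by
    calc x ⬝ᵥ ![s, 2 - s, s - 2, -s]
        = s * (x 0 - x 1) + 2 * (x 1 - x 2) + s * (x 2 - x 3) := by
          simp [dotProduct, Fin.sum_univ_four]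
          ring
      _ = s ^ 2 / c₁ + 4 / c₂ + s ^ 2 / c₃ := by
          rw [h01, h12, h23]
          ring
      _ = S := by rw [hs]
  have hnorm : ![s, 2 - s, s - 2, -s] ⬝ᵥ ![s, 2 - s, s - 2, -s] = 20 - 8 * s := by
    simp [dotProduct, Fin.sum_univ_four]
    linear_combination 4 * hs
  have hx : x ≠ 0 := by
    rintro rfl
    rw [zero_dotProduct] at hpair
    exact hSpos.ne hpair
  have hxx : 0 < x ⬝ᵥ x :=
    (Finset.sum_nonneg fun i _ => mul_self_nonneg (x i)).lt_of_ne'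
      (dotProduct_self_eq_zero.not.mpr hx)
  have hcs : S ^ 2 ≤ (x ⬝ᵥ x) * (20 - 8 * s) := by
    rw [← hpair, ← hnorm]
    simpa only [dotProduct, sq] using
      Finset.sum_mul_sq_le_sq_mul_sq Finset.univ x ![s, 2 - s, s - 2, -s]
  calc lambda2P4 c₁ c₂ c₃ * S
      ≤ S / (x ⬝ᵥ x) * S := by
        gcongr
        exact hquad ▸ lambda2P4_le_rayleigh hc₁.le hc₂.le hc₃.le hx hsum
    _ = S ^ 2 / (x ⬝ᵥ x) := by ring
    _ ≤ 20 - 8 * s := by rwa [div_le_iff₀' hxx]
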